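/- arXiv:1605.08933 — 4 statements merged into one kernel-verified Lean document; each statement's English description precedes it below -/
import Mathlib

section
/- Let W₁ and W₂ be real random variables on a common probability space such that P(|W₁| > t) ≤ C₁ exp(−C₂ t^{α₁}) and P(|W₂| > t) ≤ C₃ exp(−C₄ t^{α₂}) for all t > 0, where α₁, α₂, C₁, C₂, C₃, C₄ are positive constants. Then for all t > 0, P(|W₁W₂| > t) ≤ C₅ exp(−C₆ t^{α₁α₂/(α₁+α₂)}), where C₅ = C₁ + C₃ and C₆ = min{C₂, C₄}. -/
open MeasureTheory ProbabilityTheory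

/-- **Lemma E.1.** If `P(|W₁| > t) ≤ C₁ exp(−C₂ t^α₁)` and `P(|W₂| > t) ≤ C₃ exp(−C₄ t^α₂)`
for all `t > 0`, then `P(|W₁W₂| > t) ≤ (C₁ + C₃) exp(−min(C₂,C₄) t^{α₁α₂/(α₁+α₂)})`
for all `t > 0`. No independence is assumed. -/
theorem stmt_6 {Ω : Type*} [MeasurableSpace Ω] (μ : Measure Ω) [IsProbabilityMeasure μ]
    (W₁ W₂ : Ω → ℝ) (hW₁ : Measurable W₁) (hW₂ : Measurable W₂)
    (α₁ α₂ C₁ C₂ C₃ C₄ : ℝ)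
    (hα₁ : 0 < α₁) (hα₂ : 0 < α₂) (hC₁ : 0 < C₁) (hC₂ : 0 < C₂) (hC₃ : 0 < C₃) (hC₄ : 0 < C₄)
    (h₁ : ∀ t > 0, (μ {ω | t < |W₁ ω|}).toReal ≤ C₁ * Real.exp (-C₂ * t ^ α₁))
    (h₂ : ∀ t > 0, (μ {ω | t < |W₂ ω|}).toReal ≤ C₃ * Real.exp (-C₄ * t ^ α₂)) :
    ∀ t > 0, (μ {ω | t < |W₁ ω * W₂ ω|}).toReal ≤
      (C₁ + C₃) * Real.exp (-(min C₂ C₄) * t ^ (α₁ * α₂ / (α₁ + α₂))) := by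
  intro t ht
  have hs : 0 < α₁ + α₂ := by positivity
  have ha : 0 < t ^ (α₂ / (α₁ + α₂)) := Real.rpow_pos_of_pos ht _
  have hb : 0 < t ^ (α₁ / (α₁ + α₂)) := Real.rpow_pos_of_pos ht _
  have hab : t ^ (α₂ / (α₁ + α₂)) * t ^ (α₁ / (α₁ + α₂)) = t := by
    rw [← Real.rpow_add ht, ← add_div, add_comm α₂ α₁, div_self hs.ne', Real.rpow_one]
  have e₁ : (t ^ (α₂ / (α₁ + α₂))) ^ α₁ = t ^ (α₁ * α₂ / (α₁ + α₂)) := by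
    rw [← Real.rpow_mul ht.le]; congr 1; ring
  have e₂ : (t ^ (α₁ / (α₁ + α₂))) ^ α₂ = t ^ (α₁ * α₂ / (α₁ + α₂)) := by
    rw [← Real.rpow_mul ht.le]; congr 1; ring
  have k₁ := h₁ _ ha
  have k₂ := h₂ _ hb
  rw [e₁] at k₁
  rw [e₂] at k₂
  have hT : 0 < t ^ (α₁ * α₂ / (α₁ + α₂)) := Real.rpow_pos_of_pos ht _
  have hsub : {ω | t < |W₁ ω * W₂ ω|} ⊆
      {ω | t ^ (α₂ / (α₁ + α₂)) < |W₁ ω|} ∪ {ω | t ^ (α₁ / (α₁ + α₂)) < |W₂ ω|} := by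
    intro ω hω
    by_contra hn
    simp only [Set.mem_union, Set.mem_setOf_eq, not_or, not_lt] at hn hω
    have := mul_le_mul hn.1 hn.2 (abs_nonneg _) ha.le
    rw [hab, ← abs_mul] at this
    linarith
  have hle := (measureReal_mono (μ := μ) hsub).trans (measureReal_union_le _ _)
  simp only [measureReal_def] at hle
  have l₁ : Real.exp (-C₂ * t ^ (α₁ * α₂ / (α₁ + α₂))) ≤
      Real.exp (-(min C₂ C₄) * t ^ (α₁ * α₂ / (α₁ + α₂))) :=
    Real.exp_le_exp.2 (mul_le_mul_of_nonneg_right (neg_le_neg (min_le_left _ _)) hT.le)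
  have l₂ : Real.exp (-C₄ * t ^ (α₁ * α₂ / (α₁ + α₂))) ≤
      Real.exp (-(min C₂ C₄) * t ^ (α₁ * α₂ / (α₁ + α₂))) :=
    Real.exp_le_exp.2 (mul_le_mul_of_nonneg_right (neg_le_neg (min_le_right _ _)) hT.le)
  have m₁ := mul_le_mul_of_nonneg_left l₁ hC₁.le
  have m₂ := mul_le_mul_of_nonneg_left l₂ hC₃.le
  rw [add_mul]
  linarith
end

section
/- Let D be a nonempty finite index set, let κ₁ ≥ 0 and a, b be real constants, and let L₇, L₈ > 0. Let (A_j)_{j∈D} and (B_j)_{j∈D} be real numbers with max_{j∈D}|A_j| ≤ L₇ and min_{j∈D}|B_j| ≥ L₈, and for each integer n ≥ 1 let (Â_j^{(n)})_{j∈D} and (B̂_j^{(n)})_{j∈D} be real random variables on a common probability space. Assume that for every constant C > 0 there exist constants C₁, C₂, C₃, C₄ > 0 (depending on C but not on n) with P(max_{j∈D}|Â_j^{(n)} − A_j| ≥ C n^{−κ₁}) ≤ |D| C₁ exp(−C₂ n^{a}) + C₃ exp(−C₄ n^{b}) for all n ≥ 1, and constants C₅, C₆ > 0 with P(max_{j∈D}|B̂_j^{(n)}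 − B_j| ≥ C n^{−κ₁}) ≤ |D| C₅ exp(−C₆ n^{a}) for all n ≥ 1. Then for every constant C > 0 there exist constants C₇, C₈, C₉, C₁₀ > 0 such that for all n ≥ 1, P(max_{j∈D}|Â_j^{(n)}/B̂_j^{(n)} − A_j/B_j| ≥ C n^{−κ₁}) ≤ |D| C₇ exp(−C₈ n^{a}) + C₉ exp(−C₁₀ n^{b}). -/
open MeasureTheory ProbabilityTheory

/-- Deterministic ratio bound. -/
lemma ratio_bound_aux {L₇ L₈ C t A B x y : ℝ} (hL₇ : 0 < L₇) (hL₈ : 0 < L₈) (hC : 0 < C)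
    (ht : 0 < t) (ht1 : t ≤ 1) (hA : |A| ≤ L₇) (hB : L₈ ≤ B)
    (hx : |x - A| < C * L₈ / 4 * t)
    (hy : |y - B| < min (L₈ / 2) (C * L₈ ^ 2 / (4 * L₇)) * t) :
    |x / y - A / B| < C * t := by
  have hy1 : |y - B| < L₈ / 2 := by
    have : min (L₈ / 2) (C * L₈ ^ 2 / (4 * L₇)) * t ≤ L₈ / 2 * 1 :=
      mul_le_mul (min_le_left _ _) ht1 ht.le (by positivity)
    linarith
  have hy2 : |y - B| < C * L₈ ^ 2 / (4 * L₇) * t :=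
    hy.trans_le (mul_le_mul_of_nonneg_right (min_le_right _ _) ht.le)
  have hyl : L₈ / 2 < y := by
    have := (abs_lt.mp hy1).1
    linarith
  have hy0 : 0 < y := by linarith
  have hB0 : 0 < B := by linarith
  have e : x / y - A / B = ((x - A) - A / B * (y - B)) / y := by
    field_simp
    ring
  rw [e, abs_div, abs_of_pos hy0, div_lt_iff₀ hy0]
  have h1 : |A / B| ≤ L₇ / L₈ := by
    rw [abs_div, abs_of_pos hB0]
    exact div_le_div₀ hL₇.le hA hL₈ hB
  have h2 : |A / B * (y - B)| ≤ L₇ / L₈ * (C * L₈ ^ 2 / (4 * L₇) * t) := by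
    rw [abs_mul]
    exact mul_le_mul h1 hy2.le (abs_nonneg _) (by positivity)
  have h3 : L₇ / L₈ * (C * L₈ ^ 2 / (4 * L₇) * t) = C * L₈ / 4 * t := by
    field_simp
  have h4 := abs_sub (x - A) (A / B * (y - B))
  have h5 : C * t * (L₈ / 2) < C * t * y := mul_lt_mul_of_pos_left hyl (by positivity)
  linarith

/-- **Lemma E.12.** With `max_j |A_j| ≤ L₇` and `min_j B_j ≥ L₈ > 0` (so in particular
`min_j |B_j| ≥ L₈`), and estimates `(Â_j^{(n)})`, `(B̂_j^{(n)})` on a common (possibly varying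
with `n`) probability space: if for every `C > 0` there are `C₁, C₂, C₃, C₄ > 0` with
`P(max_j |Â_j − A_j| ≥ C n^{−κ₁}) ≤ |D| C₁ exp(−C₂ n^a) + C₃ exp(−C₄ n^b)` and
`C₅, C₆ > 0` with `P(max_j |B̂_j − B_j| ≥ C n^{−κ₁}) ≤ |D| C₅ exp(−C₆ n^a)`, then for every
`C > 0` there are `C₇, C₈, C₉, C₁₀ > 0` with
`P(max_j |Â_j/B̂_j − A_j/B_j| ≥ C n^{−κ₁}) ≤ |D| C₇ exp(−C₈ n^a) + C₉ exp(−C₁₀ n^b)`.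
(Division is Lean's, with `u/0 = 0`.) -/
theorem stmt_15 {D : Type*} [Fintype D] [Nonempty D]
    (κ₁ a b L₇ L₈ : ℝ) (hκ : 0 ≤ κ₁) (hL₇ : 0 < L₇) (hL₈ : 0 < L₈)
    (A B : D → ℝ) (hA : ∀ j, |A j| ≤ L₇) (hB : ∀ j, L₈ ≤ B j)
    (Ω : ℕ → Type) (inst : ∀ n, MeasurableSpace (Ω n))
    (μ : ∀ n, @Measure (Ω n) (inst n))
    (hμ : ∀ n, @IsProbabilityMeasure (Ω n) (inst n) (μ n))
    (Ahat Bhat : ∀ n, D → Ω n → ℝ)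
    (hAm : ∀ n j, @Measurable (Ω n) ℝ (inst n) _ (Ahat n j))
    (hBm : ∀ n j, @Measurable (Ω n) ℝ (inst n) _ (Bhat n j))
    (hhA : ∀ C > (0:ℝ), ∃ C₁ C₂ C₃ C₄ : ℝ, 0 < C₁ ∧ 0 < C₂ ∧ 0 < C₃ ∧ 0 < C₄ ∧
      ∀ n : ℕ, 1 ≤ n →
      ((μ n) {ω | ∃ j, C * (n : ℝ) ^ (-κ₁) ≤ |Ahat n j ω - A j|}).toReal ≤
        (Fintype.card D) * C₁ * Real.exp (-C₂ * (n : ℝ) ^ a) + C₃ * Real.exp (-C₄ * (n : ℝ) ^ b))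
    (hhB : ∀ C > (0:ℝ), ∃ C₅ C₆ : ℝ, 0 < C₅ ∧ 0 < C₆ ∧ ∀ n : ℕ, 1 ≤ n →
      ((μ n) {ω | ∃ j, C * (n : ℝ) ^ (-κ₁) ≤ |Bhat n j ω - B j|}).toReal ≤
        (Fintype.card D) * C₅ * Real.exp (-C₆ * (n : ℝ) ^ a)) :
    ∀ C > (0:ℝ), ∃ C₇ C₈ C₉ C₁₀ : ℝ, 0 < C₇ ∧ 0 < C₈ ∧ 0 < C₉ ∧ 0 < C₁₀ ∧
      ∀ n : ℕ, 1 ≤ n →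
      ((μ n) {ω | ∃ j, C * (n : ℝ) ^ (-κ₁) ≤
          |Ahat n j ω / Bhat n j ω - A j / B j|}).toReal ≤
        (Fintype.card D) * C₇ * Real.exp (-C₈ * (n : ℝ) ^ a) +
          C₉ * Real.exp (-C₁₀ * (n : ℝ) ^ b) := by
  intro C hC
  obtain ⟨C₁, C₂, C₃, C₄, h1, h2, h3, h4, HA⟩ := hhA (C * L₈ / 4) (by positivity)
  obtain ⟨C₅, C₆, h5, h6, HB⟩ := hhB (min (L₈ / 2) (C * L₈ ^ 2 / (4 * L₇))) (by positivity)
  refine ⟨C₁ + C₅, min C₂ C₆, C₃, C₄, by positivity, by positivity, h3, h4, ?_⟩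
  intro n hn
  have HA' := HA n hn
  have HB' := HB n hn
  have hn1 : (1 : ℝ) ≤ n := by exact_mod_cast hn
  have hn0 : (0 : ℝ) < n := by linarith
  have ht : 0 < (n : ℝ) ^ (-κ₁) := Real.rpow_pos_of_pos hn0 _
  have ht1 : (n : ℝ) ^ (-κ₁) ≤ 1 := Real.rpow_le_one_of_one_le_of_nonpos hn1 (by linarith)
  have hp : 0 < (n : ℝ) ^ a := Real.rpow_pos_of_pos hn0 _
  letI := inst n
  haveI := hμ n
  set SA := {ω | ∃ j, C * L₈ / 4 * (n : ℝ) ^ (-κ₁) ≤ |Ahat n j ω - A j|}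
  set SB := {ω | ∃ j, min (L₈ / 2) (C * L₈ ^ 2 / (4 * L₇)) * (n : ℝ) ^ (-κ₁) ≤
    |Bhat n j ω - B j|}
  have hsub : {ω | ∃ j, C * (n : ℝ) ^ (-κ₁) ≤
      |Ahat n j ω / Bhat n j ω - A j / B j|} ⊆ SA ∪ SB := by
    rintro ω ⟨j, hj⟩
    by_contra hcon
    rw [Set.mem_union, not_or] at hcon
    have hx : |Ahat n j ω - A j| < C * L₈ / 4 * (n : ℝ) ^ (-κ₁) :=
      not_le.mp fun h => hcon.1 ⟨j, h⟩
    have hy : |Bhat n j ω - B j| <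
        min (L₈ / 2) (C * L₈ ^ 2 / (4 * L₇)) * (n : ℝ) ^ (-κ₁) :=
      not_le.mp fun h => hcon.2 ⟨j, h⟩
    exact absurd hj (not_le.mpr (ratio_bound_aux hL₇ hL₈ hC ht ht1 (hA j) (hB j) hx hy))
  have hm : ((μ n) {ω | ∃ j, C * (n : ℝ) ^ (-κ₁) ≤
      |Ahat n j ω / Bhat n j ω - A j / B j|}).toReal ≤
      ((μ n) SA).toReal + ((μ n) SB).toReal := by
    rw [← ENNReal.toReal_add (measure_ne_top _ _) (measure_ne_top _ _)]
    exact ENNReal.toReal_mono (by finiteness)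
      ((measure_mono hsub).trans (measure_union_le _ _))
  have e1 : Real.exp (-C₂ * (n : ℝ) ^ a) ≤ Real.exp (-(min C₂ C₆) * (n : ℝ) ^ a) := by
    apply Real.exp_le_exp.mpr
    exact mul_le_mul_of_nonneg_right (neg_le_neg (min_le_left _ _)) hp.le
  have e2 : Real.exp (-C₆ * (n : ℝ) ^ a) ≤ Real.exp (-(min C₂ C₆) * (n : ℝ) ^ a) := by
    apply Real.exp_le_exp.mpr
    exact mul_le_mul_of_nonneg_right (neg_le_neg (min_le_right _ _)) hp.le
  have f1 := mul_le_mul_of_nonneg_left e1 (show 0 ≤ (Fintype.card D : ℝ) * C₁ by positivity)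
  have f2 := mul_le_mul_of_nonneg_left e2 (show 0 ≤ (Fintype.card D : ℝ) * C₅ by positivity)
  rw [mul_add, add_mul]
  linarith
end

section
/- Let p ≥ 1 be an integer, let β₀ ∈ ℝ, β = (β_j)_{j=1}^p ∈ ℝ^p, and γ = (γ_{kℓ})_{1≤k<ℓ≤p} be real coefficients, and let a = (a_j) ∈ ℝ^p and b = (b_j) ∈ ℝ^p with b_j ≠ 0 for all j. Define transformed coefficients β̃₀ = β₀ + Σ_{j=1}^p β_j a_j + Σ_{1≤k<ℓ≤p} γ_{kℓ} a_k a_ℓ; β̃_j = (β_j + Σ_{1≤k<j} γ_{kj} a_k + Σ_{j<k≤p} γ_{jk} a_k) b_j⁻¹ for each j; and γ̃_{kℓ} = γ_{kℓ} b_k⁻¹ b_ℓ⁻¹ for k < ℓ. Then: (i) for every x ∈ ℝ^p, writing x̃_j = b_j(x_j − a_j), one has β̃₀ + Σ_{j=1}^p β̃_j x̃_j + Σ_{1≤k<ℓ≤p} γ̃_{kℓ} x̃_k x̃_ℓ = β₀ + Σ_{j=1}^p β_j x_j + Σ_{1≤k<ℓ≤p} γ_{kℓ} x_k x_ℓ;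 and (ii) defining I = {(k,ℓ) : 1 ≤ k < ℓ ≤ p, γ_{kℓ} ≠ 0}, A = {1 ≤ k ≤ p : (k,ℓ) ∈ I or (ℓ,k) ∈ I for some ℓ}, B = {1 ≤ j ≤ p : β_j ≠ 0}, M = A ∪ B, and Ĩ, Ã, B̃, M̃ analogously from (β̃, γ̃), one has Ĩ = I, Ã = A, and M̃ = M. -/
/-- Transformed main-effect coefficients under the affine change of variables
`x_j ↦ b_j (x_j − a_j)`. -/
noncomputable def tBeta {p : ℕ} (β : Fin p → ℝ) (γ : Fin p → Fin p → ℝ)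
    (a b : Fin p → ℝ) (j : Fin p) : ℝ :=
  (β j + (∑ k, if k < j then γ k j * a k else 0)
      + ∑ k, if j < k then γ j k * a k else 0) * (b j)⁻¹

/-- Transformed interaction coefficients. -/
noncomputable def tGamma {p : ℕ} (γ : Fin p → Fin p → ℝ)
    (b : Fin p → ℝ) (k ℓ : Fin p) : ℝ :=
  γ k ℓ * (b k)⁻¹ * (b ℓ)⁻¹

/-- Transformed intercept. -/
noncomputable def tBeta0 {p : ℕ} (β₀ : ℝ) (β : Fin p → ℝ) (γ : Fin p → Fin p → ℝ)
    (a : Fin p → ℝ) : ℝ :=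
  β₀ + (∑ j, β j * a j) + ∑ k, ∑ ℓ, if k < ℓ then γ k ℓ * a k * a ℓ else 0

/-- **Invariance under affine transformations (Appendix B).**
(i) The quadratic interaction polynomial is invariant under `x_j ↦ x̃_j = b_j(x_j − a_j)`
when the coefficients are transformed as above; and (ii) the set `I` of important
interactions, the set `A` of active interaction variables, and the set `M = A ∪ B` of
important features are invariant. -/
theorem stmt_16 (p : ℕ) (hp : 1 ≤ p) (β₀ : ℝ) (β : Fin p → ℝ) (γ : Fin p → Fin p → ℝ)
    (a b : Fin p → ℝ) (hb : ∀ j, b j ≠ 0) :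
    (∀ x : Fin p → ℝ,
      tBeta0 β₀ β γ a + (∑ j, tBeta β γ a b j * (b j * (x j - a j)))
          + (∑ k, ∑ ℓ, if k < ℓ then
              tGamma γ b k ℓ * (b k * (x k - a k)) * (b ℓ * (x ℓ - a ℓ)) else 0)
        = β₀ + (∑ j, β j * x j) + ∑ k, ∑ ℓ, if k < ℓ then γ k ℓ * x k * x ℓ else 0) ∧
    ({kl : Fin p × Fin p | kl.1 < kl.2 ∧ tGamma γ b kl.1 kl.2 ≠ 0}
        = {kl : Fin p × Fin p | kl.1 < kl.2 ∧ γ kl.1 kl.2 ≠ 0}) ∧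
    ({k : Fin p | ∃ ℓ, (k < ℓ ∧ tGamma γ b k ℓ ≠ 0) ∨ (ℓ < k ∧ tGamma γ b ℓ k ≠ 0)}
        = {k : Fin p | ∃ ℓ, (k < ℓ ∧ γ k ℓ ≠ 0) ∨ (ℓ < k ∧ γ ℓ k ≠ 0)}) ∧
    ({k : Fin p | ∃ ℓ, (k < ℓ ∧ tGamma γ b k ℓ ≠ 0) ∨ (ℓ < k ∧ tGamma γ b ℓ k ≠ 0)}
        ∪ {j : Fin p | tBeta β γ a b j ≠ 0}
      = {k : Fin p | ∃ ℓ, (k < ℓ ∧ γ k ℓ ≠ 0) ∨ (ℓ < k ∧ γ ℓ k ≠ 0)}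
        ∪ {j : Fin p | β j ≠ 0}) := by
  have hg : ∀ k l, tGamma γ b k l ≠ 0 ↔ γ k l ≠ 0 := by
    intro k l
    simp [tGamma, hb]
  refine ⟨?_, ?_, ?_, ?_⟩
  · intro x
    have h1 : ∀ j, tBeta β γ a b j * (b j * (x j - a j)) =
        β j * (x j - a j) + (∑ k, if k < j then γ k j * a k * (x j - a j) else 0)
          + ∑ k, if j < k then γ j k * a k * (x j - a j) else 0 := by
      intro j
      have e1 : (∑ k, if k < j then γ k j * a k * (x j - a j) else 0)
          = (∑ k, if k < j then γ k j * a k else 0) * (x j - a j) := by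
        rw [Finset.sum_mul]
        exact Finset.sum_congr rfl fun k _ => by split_ifs <;> simp
      have e2 : (∑ k, if j < k then γ j k * a k * (x j - a j) else 0)
          = (∑ k, if j < k then γ j k * a k else 0) * (x j - a j) := by
        rw [Finset.sum_mul]
        exact Finset.sum_congr rfl fun k _ => by split_ifs <;> simp
      rw [e1, e2, tBeta]
      have := hb j
      field_simp
    have h2 : ∀ k l, tGamma γ b k l * (b k * (x k - a k)) * (b l * (x l - a l))
        = γ k l * (x k - a k) * (x l - a l) := by
      intro k l
      have := hb k
      have := hb l
      rw [tGamma]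
      field_simp
    simp only [h1, h2, tBeta0, Finset.sum_add_distrib]
    rw [Finset.sum_comm (f := fun j k => if k < j then γ k j * a k * (x j - a j) else 0)]
    have h3 : ∑ j, β j * x j = ∑ j, β j * a j + ∑ j, β j * (x j - a j) := by
      rw [← Finset.sum_add_distrib]
      exact Finset.sum_congr rfl fun k _ => by ring
    have h4 : (∑ k, ∑ l, if k < l then γ k l * x k * x l else 0)
        = (∑ k, ∑ l, if k < l then γ k l * a k * a l else 0)
        + (∑ k, ∑ l, if k < l then γ k l * a k * (x l - a l) else 0)
        + (∑ k, ∑ l, if k < l then γ k l * a l * (x k - a k) else 0)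
        + (∑ k, ∑ l, if k < l then γ k l * (x k - a k) * (x l - a l) else 0) := by
      simp only [← Finset.sum_add_distrib]
      refine Finset.sum_congr rfl fun k _ => Finset.sum_congr rfl fun l _ => ?_
      split_ifs <;> ring
    rw [h3, h4]
    ring
  · simp only [hg]
  · simp only [hg]
  · simp only [hg]
    ext j
    simp only [Set.mem_union, Set.mem_setOf_eq]
    by_cases hA : ∃ l, (j < l ∧ γ j l ≠ 0) ∨ (l < j ∧ γ l j ≠ 0)
    · simp only [hA, true_or]
    · simp only [hA, false_or]
      push Not at hA
      have e1 : (∑ k, if k < j then γ k j * a k else 0) = 0 :=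
        Finset.sum_eq_zero fun k _ => by
          split_ifs with h
          · simp [(hA k).2 h]
          · rfl
      have e2 : (∑ k, if j < k then γ j k * a k else 0) = 0 :=
        Finset.sum_eq_zero fun k _ => by
          split_ifs with h
          · simp [(hA k).1 h]
          · rfl
      rw [tBeta, e1, e2]
      simp [hb]
end

section
/- Let n, q, s ≥ 1 be integers with 2s ≤ q, let Σ̃ be a q × q real symmetric matrix, let K > 0, ε > 0, and let A be an n × q real matrix such that every entry of n⁻¹AᵀA − Σ̃ is at most ε in absolute value. Then: (i) if δᵀΣ̃δ ≥ K for every δ ∈ ℝ^q with ‖δ‖₂ = 1 and ‖δ‖₀ < 2s, then n⁻¹‖Aδ‖₂² ≥ K − 2sε for every such δ; and (ii) writing each δ ∈ ℝ^q as δ = (δ₁ᵀ, δ₂ᵀ)ᵀ with δ₁ ∈ ℝ^s, and letting δ̃₂ denote the subvector of δ₂ consisting of its s largest components in magnitude, if δᵀΣ̃δ ≥ K‖δ‖₂² for every nonzero δ with ‖δ₂‖₁ ≤ 7‖δ₁‖₁, then for every such δ, n⁻¹‖Aδ‖₂²/(‖δ₁‖₂² ∨ ‖δ̃₂‖₂²)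 ≥ K − 64sε. -/
/-- The squared Euclidean norm of the subvector of `δ` (restricted to coordinates with
index `≥ s`) consisting of its `s` largest components in magnitude: equivalently, the
largest sum of squares over subsets of those coordinates of size at most `s`. -/
noncomputable def topSqTail {q : ℕ} (s : ℕ) (δ : Fin q → ℝ) : ℝ :=
  sSup {r : ℝ | ∃ T : Finset (Fin q),
    (∀ m ∈ T, s ≤ (m : ℕ)) ∧ T.card ≤ s ∧ r = ∑ m ∈ T, δ m ^ 2}

theorem aux_gram (n q : ℕ) (Sig : Matrix (Fin q) (Fin q) ℝ) (ε : ℝ)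
    (A : Matrix (Fin n) (Fin q) ℝ)
    (hA : ∀ m m' : Fin q, |(n : ℝ)⁻¹ * (∑ i, A i m * A i m') - Sig m m'| ≤ ε)
    (δ : Fin q → ℝ) :
    (∑ m, ∑ m', δ m * Sig m m' * δ m') - ε * (∑ m, |δ m|) ^ 2
      ≤ (n : ℝ)⁻¹ * ∑ i, (∑ m, A i m * δ m) ^ 2 := by
  have h1 : (n : ℝ)⁻¹ * ∑ i, (∑ m, A i m * δ m) ^ 2
      = ∑ m, ∑ m', δ m * ((n : ℝ)⁻¹ * (∑ i, A i m * A i m')) * δ m' := by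
    have : ∀ i, (∑ m, A i m * δ m) ^ 2 = ∑ m, ∑ m', A i m * δ m * (A i m' * δ m') := by
      intro i
      rw [sq, Finset.sum_mul_sum]
    simp_rw [this]
    rw [Finset.sum_comm, Finset.mul_sum]
    refine Finset.sum_congr rfl fun m _ => ?_
    rw [Finset.sum_comm, Finset.mul_sum]
    refine Finset.sum_congr rfl fun m' _ => ?_
    simp only [Finset.mul_sum, Finset.sum_mul]
    refine Finset.sum_congr rfl fun i _ => ?_
    ring
  have h2 : ε * (∑ m, |δ m|) ^ 2 = ∑ m, ∑ m', ε * (|δ m| * |δ m'|) := by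
    rw [sq, Finset.sum_mul_sum, Finset.mul_sum]
    simp only [Finset.mul_sum]
  rw [h1, h2, ← Finset.sum_sub_distrib]
  refine Finset.sum_le_sum fun m _ => ?_
  rw [← Finset.sum_sub_distrib]
  refine Finset.sum_le_sum fun m' _ => ?_
  have h3 := mul_le_mul_of_nonneg_right (hA m m') (abs_nonneg (δ m * δ m'))
  rw [← abs_mul] at h3
  have h4 := neg_abs_le (((n : ℝ)⁻¹ * (∑ i, A i m * A i m') - Sig m m') * (δ m * δ m'))
  rw [abs_mul (δ m)] at h3
  nlinarith

theorem aux_l1 {q : ℕ} (S : Finset (Fin q)) (δ : Fin q → ℝ) :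
    (∑ m ∈ S, |δ m|) ^ 2 ≤ S.card * ∑ m ∈ S, δ m ^ 2 := by
  have := sq_sum_le_card_mul_sum_sq (s := S) (f := fun m => |δ m|)
  simpa only [sq_abs] using this

theorem aux_top {q : ℕ} (s : ℕ) (δ : Fin q → ℝ) : topSqTail s δ ≤ ∑ m, δ m ^ 2 := by
  refine csSup_le ⟨0, ∅, by simp⟩ ?_
  rintro r ⟨T, -, -, rfl⟩
  exact Finset.sum_le_sum_of_subset_of_nonneg (Finset.subset_univ _) fun _ _ _ => sq_nonneg _

/-- **Deterministic restricted-eigenvalue transfer (proof of Theorem 3).**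
If every entry of `n⁻¹AᵀA − Σ̃` is at most `ε` in absolute value, then
(i) a sparse-eigenvalue lower bound `K` for `Σ̃` yields the bound `K − 2sε` for `n⁻¹AᵀA`
over unit vectors with fewer than `2s` nonzero components; and
(ii) a restricted-eigenvalue bound `K` for `Σ̃` over the cone `‖δ₂‖₁ ≤ 7‖δ₁‖₁` yields the
bound `K − 64sε` for the ratio `n⁻¹‖Aδ‖₂²/(‖δ₁‖₂² ∨ ‖δ̃₂‖₂²)`. -/
theorem stmt_18 (n q s : ℕ) (hn : 1 ≤ n) (hq : 1 ≤ q) (hs : 1 ≤ s) (hsq : 2 * s ≤ q)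
    (Sig : Matrix (Fin q) (Fin q) ℝ) (hsym : Sig.IsSymm)
    (K ε : ℝ) (hK : 0 < K) (hε : 0 < ε)
    (A : Matrix (Fin n) (Fin q) ℝ)
    (hA : ∀ m m' : Fin q, |(n : ℝ)⁻¹ * (∑ i, A i m * A i m') - Sig m m'| ≤ ε) :
    ((∀ δ : Fin q → ℝ, (∑ m, δ m ^ 2) = 1 → {m | δ m ≠ 0}.ncard < 2 * s →
        K ≤ ∑ m, ∑ m', δ m * Sig m m' * δ m') →
      ∀ δ : Fin q → ℝ, (∑ m, δ m ^ 2) = 1 → {m | δ m ≠ 0}.ncard < 2 * s →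
        K - 2 * s * ε ≤ (n : ℝ)⁻¹ * ∑ i, (∑ m, A i m * δ m) ^ 2) ∧
    ((∀ δ : Fin q → ℝ, δ ≠ 0 →
        (∑ m : Fin q, if s ≤ (m : ℕ) then |δ m| else 0) ≤ 7 * ∑ m : Fin q, (if (m : ℕ) < s then |δ m| else 0) →
        K * (∑ m, δ m ^ 2) ≤ ∑ m, ∑ m', δ m * Sig m m' * δ m') →
      ∀ δ : Fin q → ℝ, δ ≠ 0 →
        (∑ m : Fin q, if s ≤ (m : ℕ) then |δ m| else 0) ≤ 7 * ∑ m : Fin q, (if (m : ℕ) < s then |δ m| else 0) →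
        K - 64 * s * ε ≤
          ((n : ℝ)⁻¹ * ∑ i, (∑ m, A i m * δ m) ^ 2) /
            max (∑ m : Fin q, if (m : ℕ) < s then δ m ^ 2 else 0) (topSqTail s δ)) := by
  classical
  constructor
  · intro h δ h1 h2
    have hg := aux_gram n q Sig ε A hA δ
    have hk := h δ h1 h2
    have hc : (∑ m, |δ m|) ^ 2 ≤ 2 * s := by
      have e1 : ∑ m, |δ m| = ∑ m ∈ Finset.univ.filter (fun m => δ m ≠ 0), |δ m| := by
        symm
        apply Finset.sum_filter_of_ne
        intro m _ hm h0
        exact hm (by simp [h0])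
      have e2 : ∑ m ∈ Finset.univ.filter (fun m => δ m ≠ 0), δ m ^ 2 = 1 := by
        rw [← h1]
        apply Finset.sum_filter_of_ne
        intro m _ hm h0
        exact hm (by simp [h0])
      have e3 := aux_l1 (Finset.univ.filter (fun m => δ m ≠ 0)) δ
      rw [e2, ← e1, mul_one] at e3
      have e4 : (Finset.univ.filter (fun m => δ m ≠ 0)).card < 2 * s := by
        rw [← Set.ncard_coe_finset]
        simpa using h2
      have e5 : ((Finset.univ.filter (fun m => δ m ≠ 0)).card : ℝ) ≤ 2 * s := by
        exact_mod_cast e4.le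
      exact e3.trans e5
    nlinarith
  · intro h δ h1 h2
    have hg := aux_gram n q Sig ε A hA δ
    have hk := h δ h1 h2
    set L1 := ∑ m : Fin q, (if (m : ℕ) < s then |δ m| else 0) with hL1
    set D1 := ∑ m : Fin q, (if (m : ℕ) < s then δ m ^ 2 else 0) with hD1
    have hsplit : ∑ m, |δ m| = L1 + ∑ m : Fin q, (if s ≤ (m : ℕ) then |δ m| else 0) := by
      rw [hL1, ← Finset.sum_add_distrib]
      refine Finset.sum_congr rfl fun m _ => ?_
      by_cases hm : (m : ℕ) < s
      · simp [hm, Nat.not_le.mpr hm]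
      · simp [hm, Nat.not_lt.mp hm]
    have hle : ∑ m, |δ m| ≤ 8 * L1 := by linarith
    have hpos : 0 < ∑ m, |δ m| := by
      obtain ⟨m, hm⟩ := Function.ne_iff.mp h1
      exact Finset.sum_pos' (fun _ _ => abs_nonneg _) ⟨m, Finset.mem_univ _, abs_pos.mpr hm⟩
    have hL : L1 ^ 2 ≤ s * D1 := by
      have e := aux_l1 (Finset.univ.filter (fun m : Fin q => (m : ℕ) < s)) δ
      rw [Finset.sum_filter, Finset.sum_filter] at e
      have hc : (Finset.univ.filter (fun m : Fin q => (m : ℕ) < s)).card ≤ s := by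
        have := Finset.card_le_card_of_injOn (s := Finset.univ.filter (fun m : Fin q => (m : ℕ) < s))
          (t := Finset.range s) (fun m => (m : ℕ)) (by intro m hm; simpa using hm)
          (fun a _ b _ hab => Fin.ext hab)
        simpa using this
      have hD0 : 0 ≤ D1 := Finset.sum_nonneg fun m _ => by split_ifs <;> positivity
      refine e.trans (mul_le_mul_of_nonneg_right ?_ hD0)
      exact_mod_cast hc
    have hL0 : 0 < L1 := by linarith
    have hs0 : (0 : ℝ) < s := by exact_mod_cast hs
    have hDpos : 0 < D1 := by
      by_contra hcon
      nlinarith [pow_pos hL0 2]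
    have hDM : D1 ≤ max D1 (topSqTail s δ) := le_max_left _ _
    have hMle : max D1 (topSqTail s δ) ≤ ∑ m, δ m ^ 2 := by
      refine max_le (Finset.sum_le_sum fun m _ => ?_) (aux_top s δ)
      split_ifs
      · exact le_rfl
      · positivity
    rw [le_div_iff₀ (hDpos.trans_le hDM)]
    set M := max D1 (topSqTail s δ)
    have a1 : (∑ m, |δ m|) ^ 2 ≤ 64 * (s * M) := by
      have : (∑ m, |δ m|) ^ 2 ≤ (8 * L1) ^ 2 := pow_le_pow_left₀ hpos.le hle 2
      have := mul_le_mul_of_nonneg_left hDM hs0.le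
      nlinarith
    have a2 := mul_le_mul_of_nonneg_left a1 hε.le
    have a3 := mul_le_mul_of_nonneg_left hMle hK.le
    nlinarith
end
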